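/- Let f ∈ ℝ[x,y,z] be a smooth psd ternary quartic. If the Gram spectrahedron Gram(f) has a face of dimension 1, then f has an automorphism of order 2. -/

import Mathlib

open MvPolynomial Matrix

/-- The monomial basis `x², y², z², xy, xz, yz` of `ℝ[x,y,z]₂`. -/
noncomputable def gramBasis : Fin 6 → MvPolynomial (Fin 3) ℝ :=
  ![X 0 ^ 2, X 1 ^ 2, X 2 ^ 2, X 0 * X 1, X 0 * X 2, X 1 * X 2]

/-- The Gram spectrahedron of `f`: all real symmetric psd `6×6` matrices `G` with
`Σᵢⱼ gᵢⱼ·mᵢ·mⱼ = f` for the monomial basis `m` of `ℝ[x,y,z]₂`. -/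
noncomputable def GramSpectrahedron (f : MvPolynomial (Fin 3) ℝ) :
    Set (Matrix (Fin 6) (Fin 6) ℝ) :=
  {G | G.PosSemidef ∧
    (∑ i, ∑ j, MvPolynomial.C (G i j) * (gramBasis i * gramBasis j)) = f}

/-- `f` is smooth: no nonzero complex point at which all partial derivatives of the
complexification of `f` vanish. -/
def IsSmooth (f : MvPolynomial (Fin 3) ℝ) : Prop :=
  ∀ a : Fin 3 → ℂ,
    (∀ i, eval a (pderiv i (map (algebraMap ℝ ℂ) f)) = 0) → a = 0

/-- `f` is positive semidefinite on `ℝ³`. -/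
def IsPsd (f : MvPolynomial (Fin 3) ℝ) : Prop :=
  ∀ a : Fin 3 → ℝ, 0 ≤ eval a f

/-- A face of a convex set `S`: a convex subset `F ⊆ S` such that whenever a point
of `F` lies in the open segment between two points of `S`, both endpoints lie in `F`. -/
def IsFace {E : Type*} [AddCommGroup E] [Module ℝ E] (S F : Set E) : Prop :=
  F ⊆ S ∧ Convex ℝ F ∧ ∀ x ∈ S, ∀ y ∈ S, ∀ t : ℝ, 0 < t → t < 1 →
    t • x + (1 - t) • y ∈ F → x ∈ F ∧ y ∈ F

/-- `f` has an automorphism of order 2: an `A ∈ GL₃(ℂ)`, not a scalar multiple of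
the identity, whose square is a scalar multiple of the identity, such that the
complexification of `f` satisfies `f(A·(x,y,z)ᵀ) = f(x,y,z)`. -/
def HasOrder2Aut (f : MvPolynomial (Fin 3) ℝ) : Prop :=
  ∃ A : Matrix (Fin 3) (Fin 3) ℂ, IsUnit A.det ∧
    (¬ ∃ c : ℂ, A = c • (1 : Matrix (Fin 3) (Fin 3) ℂ)) ∧
    (∃ c : ℂ, A * A = c • (1 : Matrix (Fin 3) (Fin 3) ℂ)) ∧
    aeval (fun i => ∑ j, MvPolynomial.C (A i j) * X j) (map (algebraMap ℝ ℂ) f)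
      = map (algebraMap ℝ ℂ) f

theorem quad_bound {n : ℕ} (Q : Matrix (Fin n) (Fin n) ℝ) :
    ∃ c : ℝ, 0 < c ∧ ∀ y : Fin n → ℝ, |y ⬝ᵥ (Q *ᵥ y)| ≤ c * (y ⬝ᵥ y) := by
  refine ⟨∑ i, ∑ j, |Q i j| + 1, by positivity, fun y => ?_⟩
  have hy : ∀ i, y i ^ 2 ≤ y ⬝ᵥ y := fun i => by
    rw [dotProduct]
    have := Finset.single_le_sum (f := fun i => y i * y i) (fun i _ => mul_self_nonneg (y i)) (Finset.mem_univ i)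
    simpa [sq] using this
  have h0 : 0 ≤ y ⬝ᵥ y := by
    rw [dotProduct]; exact Finset.sum_nonneg fun i _ => mul_self_nonneg _
  have : |y ⬝ᵥ (Q *ᵥ y)| ≤ (∑ i, ∑ j, |Q i j|) * (y ⬝ᵥ y) := by
    rw [dotProduct]
    refine (Finset.abs_sum_le_sum_abs _ _).trans ?_
    rw [Finset.sum_mul]
    refine Finset.sum_le_sum fun i _ => ?_
    rw [mulVec, dotProduct, Finset.mul_sum, Finset.sum_mul]
    refine (Finset.abs_sum_le_sum_abs _ _).trans ?_
    refine Finset.sum_le_sum fun j _ => ?_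
    rw [abs_mul, abs_mul]
    have h1 := hy i
    have h2 := hy j
    have h3 : |y i| * |y j| ≤ y ⬝ᵥ y := by
      nlinarith [sq_nonneg (|y i| - |y j|), sq_abs (y i), sq_abs (y j)]
    calc |y i| * (|Q i j| * |y j|) = |Q i j| * (|y i| * |y j|) := by ring
      _ ≤ _ := mul_le_mul_of_nonneg_left h3 (abs_nonneg _)
  nlinarith

theorem gen_inv {n : ℕ} (C : Matrix (Fin n) (Fin n) ℝ) :
    ∃ P : Matrix (Fin n) (Fin n) ℝ, ∀ x, C *ᵥ (P *ᵥ (C *ᵥ x)) = C *ᵥ x := by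
  obtain ⟨g, hg⟩ := LinearMap.exists_rightInverse_of_surjective (toLin' C).rangeRestrict
    (LinearMap.range_rangeRestrict _)
  obtain ⟨p, hp⟩ := LinearMap.exists_extend g
  refine ⟨LinearMap.toMatrix' p, fun x => ?_⟩
  have h1 := congrArg Subtype.val (LinearMap.congr_fun hg ((toLin' C).rangeRestrict x))
  have h2 := LinearMap.congr_fun hp ((toLin' C).rangeRestrict x)
  simp at h1 h2
  rw [LinearMap.toMatrix'_mulVec, h2, h1]

open scoped MatrixOrder Matrix.Norms.L2Operator in
theorem psd_factor {n : ℕ} (G : Matrix (Fin n) (Fin n) ℝ) (hG : G.PosSemidef) :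
    ∃ C : Matrix (Fin n) (Fin n) ℝ, G = Cᵀ * C := by
  obtain ⟨C, hC⟩ := CStarAlgebra.nonneg_iff_eq_star_mul_self.mp hG.nonneg
  exact ⟨C, by rw [hC, star_eq_conjTranspose, conjTranspose_eq_transpose_of_trivial]⟩

theorem psd_perturb {n : ℕ} (G S : Matrix (Fin n) (Fin n) ℝ) (hG : G.PosSemidef)
    (hS : Sᵀ = S) (hk : ∀ x, G *ᵥ x = 0 → S *ᵥ x = 0) :
    ∃ ε : ℝ, 0 < ε ∧ (G + ε • S).PosSemidef ∧ (G - ε • S).PosSemidef := by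
  obtain ⟨C, hC⟩ := psd_factor G hG
  obtain ⟨P, hP⟩ := gen_inv C
  have hSx : ∀ x, S *ᵥ (P *ᵥ (C *ᵥ x)) = S *ᵥ x := by
    intro x
    have : S *ᵥ (P *ᵥ (C *ᵥ x) - x) = 0 := hk _ (by
      rw [hC, ← mulVec_mulVec, mulVec_sub, hP, sub_self, mulVec_zero])
    rwa [mulVec_sub, sub_eq_zero] at this
  have hS1 : S * P * C = S := by
    ext1 i j
    have := congrFun (hSx (Pi.single j 1)) i
    rw [mulVec_mulVec, mulVec_mulVec, mulVec_single_one, mulVec_single_one] at this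
    exact this
  have hS2 : Cᵀ * (Pᵀ * S * P) * C = S := by
    have h := congrArg transpose hS1
    simp only [transpose_mul, hS] at h
    calc Cᵀ * (Pᵀ * S * P) * C = Cᵀ * (Pᵀ * S) * P * C := by simp only [Matrix.mul_assoc]
      _ = S := by rw [h, hS1]
  obtain ⟨c, hc, hb⟩ := quad_bound (Pᵀ * S * P)
  have hx1 : ∀ x, x ⬝ᵥ (S *ᵥ x) = (C *ᵥ x) ⬝ᵥ ((Pᵀ * S * P) *ᵥ (C *ᵥ x)) := by
    intro x
    conv_lhs => rw [← hS2]
    rw [← mulVec_mulVec, ← mulVec_mulVec, dotProduct_mulVec, vecMul_transpose]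
  have hx2 : ∀ x, x ⬝ᵥ (G *ᵥ x) = (C *ᵥ x) ⬝ᵥ (C *ᵥ x) := by
    intro x
    rw [hC, ← mulVec_mulVec, dotProduct_mulVec, vecMul_transpose]
  have hGt : Gᵀ = G := by simpa using hG.1.eq
  refine ⟨c⁻¹, by positivity, ?_, ?_⟩
  all_goals
    apply Matrix.PosSemidef.of_dotProduct_mulVec_nonneg
    · rw [IsHermitian, conjTranspose_eq_transpose_of_trivial]
      simp [hS, hGt]
    intro x
    have h := abs_le.mp (hb (C *ᵥ x))
    simp only [star_trivial, add_mulVec, sub_mulVec, smul_mulVec, dotProduct_add, dotProduct_sub, dotProduct_smul, smul_eq_mul]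
    rw [hx1, hx2]
    have h3 : (C *ᵥ x) ⬝ᵥ (C *ᵥ x) = c⁻¹ * (c * ((C *ᵥ x) ⬝ᵥ (C *ᵥ x))) := by field_simp
    rw [h3]
    first
      | (rw [← mul_add]; exact mul_nonneg (by positivity) (by linarith))
      | (rw [← mul_sub]; exact mul_nonneg (by positivity) (by linarith))

/-- Coordinates of a symmetric matrix. -/
def vec6 {R : Type*} (M : Matrix (Fin 3) (Fin 3) R) : Fin 6 → R :=
  ![M 0 0, M 1 1, M 2 2, M 0 1, M 0 2, M 1 2]

/-- Polarised adjugate. -/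
def crs (B M : Matrix (Fin 3) (Fin 3) ℝ) : Matrix (Fin 3) (Fin 3) ℝ :=
  adjugate (B + M) - adjugate B - adjugate M

/-- The Gram relation attached to a symmetric matrix. -/
def relMat (B : Matrix (Fin 3) (Fin 3) ℝ) : Matrix (Fin 6) (Fin 6) ℝ :=
  !![0, B 2 2, B 1 1, 0, 0, -2 * B 1 2;
     B 2 2, 0, B 0 0, 0, -2 * B 0 2, 0;
     B 1 1, B 0 0, 0, -2 * B 0 1, 0, 0;
     0, 0, -2 * B 0 1, -2 * B 2 2, 2 * B 1 2, 2 * B 0 2;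
     0, -2 * B 0 2, 0, 2 * B 1 2, -2 * B 1 1, 2 * B 0 1;
     -2 * B 1 2, 0, 0, 2 * B 0 2, 2 * B 0 1, -2 * B 0 0]

theorem relMat_symm (B) : (relMat B)ᵀ = relMat B := by
  ext i j; fin_cases i <;> fin_cases j <;> rfl

theorem relMat_smul (c : ℝ) (B) : relMat (c • B) = c • relMat B := by
  ext i j; fin_cases i <;> fin_cases j <;> simp [relMat] <;> ring

theorem relMat_inj (B B') (hB : Bᵀ = B) (hB' : B'ᵀ = B') (h : relMat B = relMat B') : B = B' := by
  have e := fun i j => congrFun (congrFun h i) j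
  have s := fun i j => congrFun (congrFun hB i) j
  have s' := fun i j => congrFun (congrFun hB' i) j
  have e01 := e 0 1
  have e02 := e 0 2
  have e12 := e 1 2
  have e05 := e 0 5
  have e14 := e 1 4
  have e23 := e 2 3
  have s01 := s 0 1
  have s02 := s 0 2
  have s12 := s 1 2
  have s01' := s' 0 1
  have s02' := s' 0 2
  have s12' := s' 1 2
  simp [relMat] at *
  ext i j; fin_cases i <;> fin_cases j <;> simp <;> linarith

theorem crs_eq (B M : Matrix (Fin 3) (Fin 3) ℝ) (hB : Bᵀ = B) (hM : Mᵀ = M) :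
    crs B M = 
   !![B 1 1 * M 2 2 + B 2 2 * M 1 1 - 2 * B 1 2 * M 1 2, B 0 2 * M 1 2 + B 1 2 * M 0 2 - B 0 1 * M 2 2 - B 2 2 * M 0 1, B 0 1 * M 1 2 + B 1 2 * M 0 1 - B 0 2 * M 1 1 - B 1 1 * M 0 2;
     B 0 2 * M 1 2 + B 1 2 * M 0 2 - B 0 1 * M 2 2 - B 2 2 * M 0 1, B 0 0 * M 2 2 + B 2 2 * M 0 0 - 2 * B 0 2 * M 0 2, B 0 1 * M 0 2 + B 0 2 * M 0 1 - B 0 0 * M 1 2 - B 1 2 * M 0 0;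
     B 0 1 * M 1 2 + B 1 2 * M 0 1 - B 0 2 * M 1 1 - B 1 1 * M 0 2, B 0 1 * M 0 2 + B 0 2 * M 0 1 - B 0 0 * M 1 2 - B 1 2 * M 0 0, B 0 0 * M 1 1 + B 1 1 * M 0 0 - 2 * B 0 1 * M 0 1] := by
  have s01 := congrFun (congrFun hB 0) 1
  have s02 := congrFun (congrFun hB 0) 2
  have s12 := congrFun (congrFun hB 1) 2
  have t01 := congrFun (congrFun hM 0) 1
  have t02 := congrFun (congrFun hM 0) 2
  have t12 := congrFun (congrFun hM 1) 2
  simp only [transpose_apply] at *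
  rw [crs, adjugate_fin_three, adjugate_fin_three, adjugate_fin_three]
  ext i j
  fin_cases i <;> fin_cases j <;> simp [s01, s02, s12, t01, t02, t12] <;> ring

theorem relMat_mulVec_zero (B M : Matrix (Fin 3) (Fin 3) ℝ) (hB : Bᵀ = B) (hM : Mᵀ = M) :
    relMat B *ᵥ vec6 M = 0 ↔ crs B M = 0 := by
  rw [crs_eq B M hB hM]
  constructor
  · intro h
    have h0 := congrFun h 0
    have h1 := congrFun h 1
    have h2 := congrFun h 2
    have h3 := congrFun h 3
    have h4 := congrFun h 4
    have h5 := congrFun h 5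
    simp [relMat, vec6, mulVec, dotProduct, Fin.sum_univ_succ] at h0 h1 h2 h3 h4 h5
    ext i j
    fin_cases i <;> fin_cases j <;> simp <;> linarith
  · intro h
    have h0 := congrFun (congrFun h 0) 0
    have h1 := congrFun (congrFun h 1) 1
    have h2 := congrFun (congrFun h 2) 2
    have h3 := congrFun (congrFun h 0) 1
    have h4 := congrFun (congrFun h 0) 2
    have h5 := congrFun (congrFun h 1) 2
    simp at h0 h1 h2 h3 h4 h5
    ext i
    fin_cases i <;> simp [relMat, vec6, mulVec, dotProduct, Fin.sum_univ_succ] <;> linarith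

theorem relMat_rel (B : Matrix (Fin 3) (Fin 3) ℝ) :
    (∑ i, ∑ j, MvPolynomial.C (relMat B i j) * (gramBasis i * gramBasis j)) = 0 := by
  apply MvPolynomial.funext
  intro x
  simp [relMat, gramBasis, Fin.sum_univ_succ]
  ring

theorem rel_exists (S : Matrix (Fin 6) (Fin 6) ℝ) (hS : Sᵀ = S)
    (h : (∑ i, ∑ j, MvPolynomial.C (S i j) * (gramBasis i * gramBasis j)) = 0) :
    ∃ B : Matrix (Fin 3) (Fin 3) ℝ, Bᵀ = B ∧ relMat B = S := by
  have s := fun i j => congrFun (congrFun hS i) j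
  simp only [transpose_apply] at s
  have e : ∀ x : Fin 3 → ℝ, _ := fun x => congrArg (eval x) h
  simp [gramBasis, Fin.sum_univ_succ] at e
  have e' : ∀ x y z : ℝ, S 0 0 * x^4 + S 1 1 * y^4 + S 2 2 * z^4 + (2 * S 0 1 + S 3 3) * (x^2*y^2)
     + (2 * S 0 2 + S 4 4) * (x^2*z^2) + (2 * S 1 2 + S 5 5) * (y^2*z^2)
     + 2 * S 0 3 * (x^3*y) + 2 * S 0 4 * (x^3*z) + 2 * S 1 3 * (x*y^3) + 2 * S 1 5 * (y^3*z)
     + 2 * S 2 4 * (x*z^3) + 2 * S 2 5 * (y*z^3) + 2 * (S 0 5 + S 3 4) * (x^2*y*z)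
     + 2 * (S 1 4 + S 3 5) * (x*y^2*z) + 2 * (S 2 3 + S 4 5) * (x*y*z^2) = 0 := by
    intro x y z
    have := e ![x,y,z]
    simp [s 0 1, s 0 2, s 0 3, s 0 4, s 0 5, s 1 2, s 1 3, s 1 4, s 1 5, s 2 3, s 2 4, s 2 5, s 3 4, s 3 5, s 4 5] at this
    linear_combination this
  clear e
  have p1 := e' 1 0 0
  have p2 := e' 0 1 0
  have p3 := e' 0 0 1
  have p4 := e' 1 1 0
  have p5 := e' 1 (-1) 0
  have p6 := e' 1 2 0
  have p7 := e' 1 0 1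
  have p8 := e' 1 0 (-1)
  have p9 := e' 1 0 2
  have p10 := e' 0 1 1
  have p11 := e' 0 1 (-1)
  have p12 := e' 0 1 2
  have p13 := e' 1 1 1
  have p14 := e' (-1) 1 1
  have p15 := e' 1 (-1) 1
  clear e'
  norm_num at p1 p2 p3
  have q1 := s 0 1
  have q2 := s 0 2
  have q3 := s 0 3
  have q4 := s 0 4
  have q5 := s 0 5
  have q6 := s 1 2
  have q7 := s 1 3
  have q8 := s 1 4
  have q9 := s 1 5
  have q10 := s 2 3
  have q11 := s 2 4
  have q12 := s 2 5
  have q13 := s 3 4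
  have q14 := s 3 5
  have q15 := s 4 5
  clear s
  simp only [p1, p2, p3] at p4 p5 p6 p7 p8 p9 p10 p11 p12 p13 p14 p15
  norm_num at p4 p5 p6 p7 p8 p9 p10 p11 p12 p13 p14 p15
  have r1 : 2 * S 0 1 + S 3 3 = 0 := by linarith
  have r2 : S 0 3 = 0 := by linarith
  have r3 : S 1 3 = 0 := by linarith
  have r4 : 2 * S 0 2 + S 4 4 = 0 := by linarith
  have r5 : S 0 4 = 0 := by linarith
  have r6 : S 2 4 = 0 := by linarith
  have r7 : 2 * S 1 2 + S 5 5 = 0 := by linarith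
  have r8 : S 1 5 = 0 := by linarith
  have r9 : S 2 5 = 0 := by linarith
  have r10 : S 0 5 + S 3 4 = 0 := by linarith
  have r11 : S 1 4 + S 3 5 = 0 := by linarith
  have r12 : S 2 3 + S 4 5 = 0 := by linarith
  clear p4 p5 p6 p7 p8 p9 p10 p11 p12 p13 p14 p15
  refine ⟨!![S 1 2, - S 2 3 / 2, - S 1 4 / 2; - S 2 3 / 2, S 0 2, - S 0 5 / 2; - S 1 4 / 2, - S 0 5 / 2, S 0 1], ?_, ?_⟩
  · ext i j; fin_cases i <;> fin_cases j <;> simp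
  · ext i j; fin_cases i <;> fin_cases j <;> simp [relMat] <;> linarith

/-- Smoothness excludes rank-one elements in the (complexified) kernel of a Gram matrix. -/
theorem no_rank_one (f : MvPolynomial (Fin 3) ℝ) (hsm : IsSmooth f)
    (G : Matrix (Fin 6) (Fin 6) ℝ) (hGs : Gᵀ = G)
    (hG : (∑ i, ∑ j, MvPolynomial.C (G i j) * (gramBasis i * gramBasis j)) = f)
    (a : Fin 3 → ℂ) (ha : G.map (algebraMap ℝ ℂ) *ᵥ vec6 (vecMulVec a a) = 0) : a = 0 := by
  apply hsm
  let m : Fin 6 → MvPolynomial (Fin 3) ℂ := fun i => map (algebraMap ℝ ℂ) (gramBasis i)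
  have hm : ∀ i, eval a (m i) = vec6 (vecMulVec a a) i := by
    intro i
    fin_cases i <;> simp [m, gramBasis, vec6, vecMulVec_apply] <;> ring
  have hs : ∀ i j, G i j = G j i := fun i j => congrFun (congrFun hGs.symm i) j
  have h1 : ∀ i, ∑ j, (G i j : ℂ) * eval a (m j) = 0 := by
    intro i
    have := congrFun ha i
    simp only [hm]
    simpa [mulVec, dotProduct] using this
  intro k
  rw [← hG]
  have : eval a (pderiv k (map (algebraMap ℝ ℂ) (∑ i, ∑ j, MvPolynomial.C (G i j) * (gramBasis i * gramBasis j))))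
     = ∑ i, ∑ j, (G i j : ℂ) * (eval a (pderiv k (m i)) * eval a (m j)) + ∑ i, ∑ j, (G i j : ℂ) * (eval a (m i) * eval a (pderiv k (m j))) := by
    rw [← Finset.sum_add_distrib]
    simp only [map_sum, map_mul, MvPolynomial.map_C, pderiv_mul, map_add]
    refine Finset.sum_congr rfl fun i _ => ?_
    rw [← Finset.sum_add_distrib]
    refine Finset.sum_congr rfl fun j _ => ?_
    simp [m]
    ring
  rw [this, Finset.sum_comm (γ := Fin 6) (f := fun i j => (G i j : ℂ) * (eval a (m i) * eval a (pderiv k (m j))))]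
  have h2 : ∀ i, ∑ j, (G i j : ℂ) * (eval a (pderiv k (m i)) * eval a (m j)) = 0 := by
    intro i
    calc _ = eval a (pderiv k (m i)) * ∑ j, (G i j : ℂ) * eval a (m j) := by
          rw [Finset.mul_sum]; exact Finset.sum_congr rfl fun j _ => by ring
      _ = 0 := by rw [h1, mul_zero]
  have h3 : ∀ j, ∑ i, (G i j : ℂ) * (eval a (m i) * eval a (pderiv k (m j))) = 0 := by
    intro j
    calc _ = eval a (pderiv k (m j)) * ∑ i, (G j i : ℂ) * eval a (m i) := by
          rw [Finset.mul_sum]; exact Finset.sum_congr rfl fun i _ => by rw [hs i j]; ring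
      _ = 0 := by rw [h1, mul_zero]
  simp [h2, h3]

theorem crs_congr (P B M : Matrix (Fin 3) (Fin 3) ℝ) :
    crs (P * B * Pᵀ) (P * M * Pᵀ) = adjugate Pᵀ * crs B M * adjugate P := by
  have h : P * B * Pᵀ + P * M * Pᵀ = P * (B + M) * Pᵀ := by
    rw [Matrix.mul_add, Matrix.add_mul]
  rw [crs, h]
  simp only [adjugate_mul_distrib, crs, Matrix.mul_sub, Matrix.sub_mul, Matrix.mul_assoc]

/-- The linear-algebra situation produced by a one-dimensional face. -/
structure GoodPair (K : Submodule ℝ (Matrix (Fin 3) (Fin 3) ℝ))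
    (B : Matrix (Fin 3) (Fin 3) ℝ) : Prop where
  symm : ∀ M ∈ K, Mᵀ = M
  bs : Bᵀ = B
  bK : ∀ M ∈ K, crs B M = 0
  uniq : ∀ B', B'ᵀ = B' → (∀ M ∈ K, crs B' M = 0) → ∃ c : ℝ, B' = c • B
  no1 : ∀ M₁ ∈ K, ∀ M₂ ∈ K, ∀ (t : ℂ) (a : Fin 3 → ℂ),
    vecMulVec a a = M₁.map (algebraMap ℝ ℂ) + t • M₂.map (algebraMap ℝ ℂ) → a = 0

/-- The desired conclusion on the kernel space. -/
def HasRefl (K : Submodule ℝ (Matrix (Fin 3) (Fin 3) ℝ)) : Prop :=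
  ∃ p φ : Fin 3 → ℝ, φ ⬝ᵥ p = 1 ∧ ∀ w, φ ⬝ᵥ w = 0 → vecMulVec p w + vecMulVec w p ∈ K

/-- Congruence as a linear map. -/
def congrMap (P : Matrix (Fin 3) (Fin 3) ℝ) :
    Matrix (Fin 3) (Fin 3) ℝ →ₗ[ℝ] Matrix (Fin 3) (Fin 3) ℝ where
  toFun M := P * M * Pᵀ
  map_add' M N := by rw [Matrix.mul_add, Matrix.add_mul]
  map_smul' c M := by simp

theorem good_congr (K) (B P : Matrix (Fin 3) (Fin 3) ℝ) (hP : Pᵀ * P = 1) (hP' : P * Pᵀ = 1)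
    (h : GoodPair K B) : GoodPair (K.comap (congrMap P)) (Pᵀ * B * P) := by
  have key : ∀ M, Pᵀ * (P * M * Pᵀ) * P = M := fun M => by
    calc Pᵀ * (P * M * Pᵀ) * P = (Pᵀ * P) * M * (Pᵀ * P) := by simp only [Matrix.mul_assoc]
      _ = M := by rw [hP]; simp
  have key' : ∀ M, P * (Pᵀ * M * P) * Pᵀ = M := fun M => by
    calc P * (Pᵀ * M * P) * Pᵀ = (P * Pᵀ) * M * (P * Pᵀ) := by simp only [Matrix.mul_assoc]
      _ = M := by rw [hP']; simp
  have cz : ∀ B M, crs B M = 0 → crs (Pᵀ * B * P) (Pᵀ * M * P) = 0 := fun B M h => by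
    have := crs_congr Pᵀ B M
    rw [transpose_transpose] at this
    rw [this, h]; simp
  have cz' : ∀ B M, crs B M = 0 → crs (P * B * Pᵀ) (P * M * Pᵀ) = 0 := fun B M h => by
    rw [crs_congr, h]; simp
  constructor
  · intro M hM
    have := h.symm _ hM
    simp only [congrMap, LinearMap.coe_mk, AddHom.coe_mk] at this
    have h1 : (P * M * Pᵀ)ᵀ = P * Mᵀ * Pᵀ := by simp [Matrix.mul_assoc]
    rw [h1] at this
    have h2 := congrArg (fun N => Pᵀ * N * P) this
    simp only [key] at h2
    exact h2
  · simp [Matrix.mul_assoc, h.bs]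
  · intro M hM
    have := cz _ _ (h.bK _ hM)
    simp only [congrMap, LinearMap.coe_mk, AddHom.coe_mk] at this
    rwa [key] at this
  · intro B' hB' hK
    obtain ⟨c, hc⟩ := h.uniq (P * B' * Pᵀ) (by simp [Matrix.mul_assoc, hB']) (by
      intro M hM
      have := cz' B' (Pᵀ * M * P) (hK _ (by
        simp only [Submodule.mem_comap, congrMap, LinearMap.coe_mk, AddHom.coe_mk]
        rwa [key']))
      rwa [key'] at this)
    refine ⟨c, ?_⟩
    rw [← key B', hc]; simp
  · intro M₁ h1 M₂ h2 t a ha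
    have := h.no1 _ h1 _ h2 t (P.map (algebraMap ℝ ℂ) *ᵥ a) (by
      have e := congrArg (fun N => P.map (algebraMap ℝ ℂ) * N * (P.map (algebraMap ℝ ℂ))ᵀ) ha
      simp only [congrMap, LinearMap.coe_mk, AddHom.coe_mk, Matrix.map_mul]
      simp only [mul_vecMulVec, vecMulVec_mul, vecMul_transpose] at e
      rw [e]
      simp only [Matrix.mul_add, Matrix.add_mul, Matrix.mul_smul, Matrix.smul_mul, transpose_map])
    have e2 := congrArg (fun v => (Pᵀ).map (algebraMap ℝ ℂ) *ᵥ v) this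
    simp only [mulVec_mulVec, mulVec_zero] at e2
    rw [← Matrix.map_mul, hP] at e2
    simpa using e2

theorem refl_congr (K) (P : Matrix (Fin 3) (Fin 3) ℝ) (hP : Pᵀ * P = 1) (hP' : P * Pᵀ = 1)
    (h : HasRefl (K.comap (congrMap P))) : HasRefl K := by
  obtain ⟨p, φ, h1, h2⟩ := h
  refine ⟨P *ᵥ p, P *ᵥ φ, ?_, fun w hw => ?_⟩
  · rw [dotProduct_mulVec, ← mulVec_transpose, mulVec_mulVec, hP, one_mulVec, h1]
  · have := h2 (Pᵀ *ᵥ w) (by rw [dotProduct_mulVec, vecMul_transpose, hw])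
    simp only [Submodule.mem_comap, congrMap, LinearMap.coe_mk, AddHom.coe_mk] at this
    simpa only [Matrix.mul_add, Matrix.add_mul, mul_vecMulVec, vecMulVec_mul, vecMul_transpose,
      mulVec_mulVec, hP', one_mulVec] using this

theorem core (K) (d : Fin 3 → ℝ) (h : GoodPair K (diagonal d)) (h0 : d 0 ≠ 0)
    (h12 : d 1 = 0 → d 2 = 0) : HasRefl K := by
  have eqs : ∀ M ∈ K, (d 1 * M 2 2 + d 2 * M 1 1 = 0 ∧ d 0 * M 2 2 + d 2 * M 0 0 = 0 ∧
      d 0 * M 1 1 + d 1 * M 0 0 = 0) ∧ d 2 * M 0 1 = 0 ∧ d 1 * M 0 2 = 0 ∧ d 0 * M 1 2 = 0 := by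
    intro M hM
    have := h.bK M hM
    rw [crs_eq _ _ h.bs (h.symm M hM)] at this
    have a0 := congrFun (congrFun this 0) 0
    have a1 := congrFun (congrFun this 1) 1
    have a2 := congrFun (congrFun this 2) 2
    have a3 := congrFun (congrFun this 0) 1
    have a4 := congrFun (congrFun this 0) 2
    have a5 := congrFun (congrFun this 1) 2
    simp [diagonal] at a0 a1 a2 a3 a4 a5
    refine ⟨⟨by linarith, by linarith, by linarith⟩, ?_, ?_, ?_⟩ <;> simp <;> tauto
  have sym : ∀ M ∈ K, M 1 0 = M 0 1 ∧ M 2 0 = M 0 2 ∧ M 2 1 = M 1 2 := by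
    intro M hM
    have := h.symm M hM
    exact ⟨congrFun (congrFun this 0) 1, congrFun (congrFun this 0) 2, congrFun (congrFun this 1) 2⟩
  -- the space is nonzero
  have hK : ∃ M ∈ K, M ≠ 0 := by
    by_contra! hc
    obtain ⟨c, hcc⟩ := h.uniq (!![0, 1, 0; 1, 0, 0; 0, 0, 0])
      (by ext i j; fin_cases i <;> fin_cases j <;> simp) (by
        intro M hM; rw [hc M hM]; simp [crs])
    have := congrFun (congrFun hcc 0) 1
    simp at this
  by_cases hd1 : d 1 = 0
  · have hd2 := h12 hd1
    have form : ∀ M ∈ K, M = !![M 0 0, M 0 1, M 0 2; M 0 1, 0, 0; M 0 2, 0, 0] := by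
      intro M hM
      obtain ⟨⟨-, e1, e2⟩, -, -, e3⟩ := eqs M hM
      obtain ⟨s1, s2, s3⟩ := sym M hM
      rw [hd2] at e1; rw [hd1] at e2
      simp [h0] at e1 e2 e3
      ext i j; fin_cases i <;> fin_cases j <;> simp [s1, s2, s3, e1, e2, e3]
    have zer : ∀ M ∈ K, M 1 0 = M 0 1 ∧ M 2 0 = M 0 2 ∧ M 1 1 = 0 ∧ M 1 2 = 0 ∧ M 2 1 = 0 ∧
        M 2 2 = 0 := by
      intro M hM
      have := fun i j => congrFun (congrFun (form M hM) i) j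
      exact ⟨this 1 0, this 2 0, this 1 1, this 1 2, this 2 1, this 2 2⟩
    have notp : ∀ M ∈ K, M 0 1 = 0 → M 0 2 = 0 → M = 0 := by
      intro M hM e1 e2
      have hf := form M hM
      rw [e1, e2] at hf
      by_contra hne
      have h00 : M 0 0 ≠ 0 := by
        intro hz; rw [hz] at hf; apply hne; rw [hf]
        ext i j; fin_cases i <;> fin_cases j <;> simp
      have := h.no1 ((M 0 0)⁻¹ • M) (K.smul_mem _ hM) 0 K.zero_mem 0 ![1, 0, 0] (by
        rw [hf]
        ext i j; fin_cases i <;> fin_cases j <;> simp [vecMulVec_apply, h00])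
      have := congrFun this 0
      simp at this
    obtain ⟨M, hM, hne⟩ := hK
    obtain ⟨N, hN, hyz⟩ : ∃ N ∈ K, M 0 1 * N 0 2 - M 0 2 * N 0 1 ≠ 0 := by
      by_contra! hc
      -- all elements are multiples of M
      have mult : ∀ N ∈ K, ∃ s : ℝ, N = s • M := by
        intro N hN
        have hcN := hc N hN
        by_cases hb : M 0 1 = 0
        · have hb2 : M 0 2 ≠ 0 := fun hz => hne (notp M hM hb hz)
          refine ⟨N 0 2 / M 0 2, ?_⟩
          have := notp (N - (N 0 2 / M 0 2) • M) (K.sub_mem hN (K.smul_mem _ hM))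
            (by simp; field_simp; linear_combination -hcN) (by simp; field_simp; ring)
          exact sub_eq_zero.mp this
        · refine ⟨N 0 1 / M 0 1, ?_⟩
          have := notp (N - (N 0 1 / M 0 1) • M) (K.sub_mem hN (K.smul_mem _ hM))
            (by simp; field_simp; ring) (by simp; field_simp; linear_combination hcN) 
          exact sub_eq_zero.mp this
      let w : Fin 3 → ℝ := ![M 0 0 / 2, M 0 1, M 0 2]
      have hws : (vecMulVec w w)ᵀ = vecMulVec w w := by
        ext i j; simp [vecMulVec_apply, mul_comm]
      obtain ⟨c, hcc⟩ := h.uniq (vecMulVec w w) hws (by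
        intro N hN
        obtain ⟨s, rfl⟩ := mult N hN
        rw [crs_eq _ _ hws (h.symm _ hN)]
        have hf := form M hM
        have f11 := congrFun (congrFun hf 1) 1
        have f12 := congrFun (congrFun hf 1) 2
        have f22 := congrFun (congrFun hf 2) 2
        simp at f11 f12 f22
        ext i j; fin_cases i <;> fin_cases j <;> simp [vecMulVec_apply, w, f11, f12, f22] <;> ring)
      have c1 := congrFun (congrFun hcc 1) 1
      have c2 := congrFun (congrFun hcc 2) 2
      simp [vecMulVec_apply, w, hd1, hd2] at c1 c2
      exact hne (notp M hM c1 c2)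
    -- now build the functional
    let D := M 0 1 * N 0 2 - M 0 2 * N 0 1
    have hD : D ≠ 0 := hyz
    refine ⟨![1, 0, 0], ![1, (-(M 0 0 / 2) * N 0 2 + M 0 2 * (N 0 0 / 2)) / D,
      (-(M 0 1) * (N 0 0 / 2) + (M 0 0 / 2) * N 0 1) / D], ?_, ?_⟩
    · simp [dotProduct, Fin.sum_univ_succ]
    · intro w hw
      simp [dotProduct, Fin.sum_univ_succ] at hw
      have : vecMulVec ![1, 0, 0] w + vecMulVec w ![1, 0, 0] =
          ((w 1 * N 0 2 - w 2 * N 0 1) / D) • M + ((-w 1 * M 0 2 + w 2 * M 0 1) / D) • N := by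
        have hw' : w 0 = (w 1 * N 0 2 - w 2 * N 0 1) / D * (M 0 0 / 2) +
            (-w 1 * M 0 2 + w 2 * M 0 1) / D * (N 0 0 / 2) := by
          field_simp
          field_simp at hw
          linear_combination hw
        have hDD : D = M 0 1 * N 0 2 - M 0 2 * N 0 1 := rfl
        obtain ⟨a1, a2, a3, a4, a5, a6⟩ := zer M hM
        obtain ⟨b1, b2, b3, b4, b5, b6⟩ := zer N hN
        ext i j; fin_cases i <;> fin_cases j <;>
          simp only [Matrix.add_apply, vecMulVec_apply, Matrix.smul_apply] <;>
          simp [a1, a2, a3, a4, a5, a6, b1, b2, b3, b4, b5, b6] <;>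
          first
            | (rw [hw']; ring1)
            | (field_simp; rw [hDD]; ring1)
      rw [this]
      exact K.add_mem (K.smul_mem _ hM) (K.smul_mem _ hN)
  by_cases hd2 : d 2 = 0
  · exfalso
    have form : ∀ M ∈ K, M = (M 0 0 / d 0) • !![d 0, 0, 0; 0, -d 1, 0; 0, 0, 0] +
        M 0 1 • !![0, 1, 0; 1, 0, 0; 0, 0, 0] := by
      intro M hM
      obtain ⟨⟨e0, e1, e2⟩, -, e4, e3⟩ := eqs M hM
      obtain ⟨s1, s2, s3⟩ := sym M hM
      rw [hd2] at e1
      simp [h0, hd1] at e1 e3 e4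
      have e2' : M 1 1 = - (M 0 0 / d 0 * d 1) := by field_simp; linear_combination e2
      ext i j; fin_cases i <;> fin_cases j <;> simp [s1, s2, s3, e1, e2', e3, e4, h0]
    have z2 : ∀ M ∈ K, M 0 2 = 0 ∧ M 1 2 = 0 ∧ M 2 2 = 0 ∧ M 1 1 = - (M 0 0 / d 0 * d 1) := by
      intro M hM
      obtain ⟨⟨e0, e1, e2⟩, -, e4, e3⟩ := eqs M hM
      rw [hd2] at e1
      simp [h0, hd1] at e1 e3 e4
      refine ⟨e4, e3, e1, ?_⟩
      field_simp; linear_combination e2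
    obtain ⟨M, hM, hne⟩ := hK
    have hMne : ¬ (M 0 0 = 0 ∧ M 0 1 = 0) := by
      rintro ⟨a, b⟩
      apply hne
      rw [form M hM, a, b]; simp
    obtain ⟨N, hN, hdet⟩ : ∃ N ∈ K, M 0 0 * N 0 1 - M 0 1 * N 0 0 ≠ 0 := by
      by_contra! hc
      let B' : Matrix (Fin 3) (Fin 3) ℝ :=
        !![M 0 1 * d 0, - (M 0 0 * d 1), 0; - (M 0 0 * d 1), - (M 0 1 * d 1), 0; 0, 0, 0]
      have hB' : B'ᵀ = B' := by
        ext i j; fin_cases i <;> fin_cases j <;> simp [B']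
      obtain ⟨c, hcc⟩ := h.uniq B' hB' (by
        intro N hN
        rw [crs_eq _ _ hB' (h.symm N hN)]
        obtain ⟨z1, z2, z3, z4⟩ := z2 N hN
        have hcN := hc N hN
        ext i j; fin_cases i <;> fin_cases j <;> simp [B', z1, z2, z3, z4] 
        field_simp
        linear_combination (2 * d 1) * hcN)
      have c0 := congrFun (congrFun hcc 0) 0
      have c1 := congrFun (congrFun hcc 1) 1
      have c2 := congrFun (congrFun hcc 0) 1
      simp [B', h0, hd1] at c0 c1 c2
      rw [← c0] at c1
      have c3 : M 0 1 * d 1 = 0 := by linarith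
      exact hMne ⟨c2, by simpa [hd1] using c3⟩
    let D := M 0 0 * N 0 1 - M 0 1 * N 0 0
    have hD : D ≠ 0 := hdet
    have hDD : D = M 0 0 * N 0 1 - M 0 1 * N 0 0 := rfl
    have m1 : !![d 0, 0, 0; 0, -d 1, 0; 0, 0, 0] ∈ K := by
      have : !![d 0, 0, 0; 0, -d 1, 0; 0, 0, 0] = (d 0 * N 0 1 / D) • M - (d 0 * M 0 1 / D) • N := by
        rw [form M hM, form N hN]
        ext i j; fin_cases i <;> fin_cases j <;> simp <;> field_simp <;> rw [hDD] <;> ring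
      rw [this]
      exact K.sub_mem (K.smul_mem _ hM) (K.smul_mem _ hN)
    have m2 : !![0, 1, 0; 1, 0, 0; 0, 0, 0] ∈ K := by
      have : !![0, 1, 0; 1, 0, 0; 0, 0, 0] = (-(N 0 0) / D) • M + (M 0 0 / D) • N := by
        rw [form M hM, form N hN]
        ext i j; fin_cases i <;> fin_cases j <;> simp <;> field_simp <;> (try rw [hDD]) <;> ring
      rw [this]
      exact K.add_mem (K.smul_mem _ hM) (K.smul_mem _ hN)
    obtain ⟨t, ht⟩ := IsAlgClosed.exists_pow_nat_eq (-(d 1 / d 0 : ℝ) : ℂ) (n := 2) (by norm_num)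
    have := h.no1 _ (K.smul_mem (d 0)⁻¹ m1) _ m2 t ![1, t, 0] (by
      ext i j; fin_cases i <;> fin_cases j <;> simp [vecMulVec_apply, h0]
      rw [← sq, ht]; push_cast; field_simp)
    have := congrFun this 0
    simp at this
  · exfalso
    obtain ⟨M, hM, hne⟩ := hK
    obtain ⟨⟨e0, e1, e2⟩, e5, e4, e3⟩ := eqs M hM
    obtain ⟨s1, s2, s3⟩ := sym M hM
    simp [h0, hd1, hd2] at e3 e4 e5
    have e6 : (d 1 * d 2) * M 0 0 = 0 := by
      linear_combination (d 1 * e1 + d 2 * e2 - d 0 * e0) / 2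
    have z0 : M 0 0 = 0 := by simpa [hd1, hd2] using e6
    rw [z0] at e1 e2
    simp [h0] at e1 e2
    apply hne
    ext i j; fin_cases i <;> fin_cases j <;> simp [s1, s2, s3, z0, e1, e2, e3, e4, e5]

theorem diag_form (B : Matrix (Fin 3) (Fin 3) ℝ) (hB : Bᵀ = B) (hne : B ≠ 0) :
    ∃ (P : Matrix (Fin 3) (Fin 3) ℝ) (d : Fin 3 → ℝ), Pᵀ * P = 1 ∧ P * Pᵀ = 1 ∧
      Pᵀ * B * P = diagonal d ∧ d 0 ≠ 0 ∧ (d 1 = 0 → d 2 = 0) := by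
  have hH : B.IsHermitian := by rw [IsHermitian, conjTranspose_eq_transpose_of_trivial, hB]
  obtain ⟨U, l, hU, hU', hUB⟩ : ∃ (U : Matrix (Fin 3) (Fin 3) ℝ) (l : Fin 3 → ℝ),
      Uᵀ * U = 1 ∧ U * Uᵀ = 1 ∧ Uᵀ * B * U = diagonal l := by
    have u1 := Unitary.coe_star_mul_self hH.eigenvectorUnitary
    have u2 := mul_eq_one_comm.mp u1
    have sp := hH.spectral_theorem
    rw [Unitary.conjStarAlgAut_apply] at sp
    rw [star_eq_conjTranspose, conjTranspose_eq_transpose_of_trivial] at u1 u2 sp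
    refine ⟨(hH.eigenvectorUnitary : Matrix (Fin 3) (Fin 3) ℝ), hH.eigenvalues, u1, u2, ?_⟩
    set U : Matrix (Fin 3) (Fin 3) ℝ := hH.eigenvectorUnitary.1 with hUdef
    have e : ∀ D, Uᵀ * (U * D * Uᵀ) * U = D := fun D => by
      calc Uᵀ * (U * D * Uᵀ) * U = (Uᵀ * U) * D * (Uᵀ * U) := by simp only [Matrix.mul_assoc]
        _ = D := by rw [u1]; simp
    calc Uᵀ * B * U = Uᵀ * (U * diagonal (RCLike.ofReal ∘ hH.eigenvalues) * Uᵀ) * U := by rw [← sp]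
      _ = _ := by rw [e]; rfl
  have hl : ¬ (l 0 = 0 ∧ l 1 = 0 ∧ l 2 = 0) := by
    rintro ⟨a, b, c⟩
    have : diagonal l = 0 := by
      ext i j; fin_cases i <;> fin_cases j <;> simp [a, b, c]
    rw [this] at hUB
    apply hne
    calc B = (U * Uᵀ) * B * (U * Uᵀ) := by rw [hU']; simp
      _ = U * (Uᵀ * B * U) * Uᵀ := by simp only [Matrix.mul_assoc]
      _ = 0 := by rw [hUB]; simp
  obtain ⟨σ, hσ0, hσ1⟩ : ∃ σ : Equiv.Perm (Fin 3), l (σ 0) ≠ 0 ∧ (l (σ 1) = 0 → l (σ 2) = 0) := by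
    by_cases a : l 0 = 0
    · by_cases b : l 1 = 0
      · exact ⟨Equiv.swap 0 2, by simpa using fun c => hl ⟨a, b, c⟩, fun _ => by simpa using a⟩
      · by_cases c : l 2 = 0
        · refine ⟨Equiv.swap 0 1, by simpa using b, fun _ => ?_⟩
          rw [Equiv.swap_apply_of_ne_of_ne (by decide) (by decide)]; exact c
        · refine ⟨Equiv.swap 0 2, by simpa using c, fun _ => by simpa using a⟩
    · by_cases b : l 1 = 0
      · exact ⟨Equiv.swap 1 2, by rw [Equiv.swap_apply_of_ne_of_ne (by decide) (by decide)]; exact a,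
          fun _ => by simpa using b⟩
      · exact ⟨1, a, fun hh => absurd hh b⟩
  refine ⟨U.submatrix id σ, l ∘ σ, ?_, ?_, ?_, hσ0, hσ1⟩
  · ext i j
    have := congrFun (congrFun hU (σ i)) (σ j)
    simpa [Matrix.mul_apply, one_apply] using this
  · rw [transpose_submatrix, submatrix_mul_equiv U Uᵀ id σ id, hU']
    simp
  · have h1 : (U.submatrix id σ)ᵀ * B = (Uᵀ * B).submatrix σ id := by
      ext i j; simp [Matrix.mul_apply]
    have h2 : (Uᵀ * B).submatrix σ id * U.submatrix id σ = (Uᵀ * B * U).submatrix σ σ := by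
      ext i j; simp [Matrix.mul_apply]
    rw [h1, h2, hUB]
    ext i j; simp [diagonal_apply]

theorem good_refl (K B) (h : GoodPair K B) (hne : B ≠ 0) : HasRefl K := by
  obtain ⟨P, d, h1, h2, h3, h4, h5⟩ := diag_form B h.bs hne
  have := good_congr K B P h1 h2 h
  rw [h3] at this
  exact refl_congr K P h1 h2 (core _ d this h4 h5)

/-- The kernel of a Gram matrix, as a space of symmetric `3×3` matrices. -/
def kerSpace (G : Matrix (Fin 6) (Fin 6) ℝ) : Submodule ℝ (Matrix (Fin 3) (Fin 3) ℝ) where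
  carrier := {M | Mᵀ = M ∧ G *ᵥ vec6 M = 0}
  zero_mem' := ⟨by simp, by
    have : vec6 (0 : Matrix (Fin 3) (Fin 3) ℝ) = 0 := by
      ext i; fin_cases i <;> rfl
    rw [this, mulVec_zero]⟩
  add_mem' := by
    rintro M N ⟨h1, h2⟩ ⟨h3, h4⟩
    refine ⟨by rw [transpose_add, h1, h3], ?_⟩
    have : vec6 (M + N) = vec6 M + vec6 N := by
      ext i; fin_cases i <;> rfl
    rw [this, mulVec_add, h2, h4, add_zero]
  smul_mem' := by
    rintro c M ⟨h1, h2⟩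
    refine ⟨by rw [transpose_smul, h1], ?_⟩
    have : vec6 (c • M) = c • vec6 M := by
      ext i; fin_cases i <;> rfl
    rw [this, mulVec_smul, h2, smul_zero]

theorem eval_gram (G : Matrix (Fin 6) (Fin 6) ℝ) (a : Fin 3 → ℝ) :
    eval a (∑ i, ∑ j, MvPolynomial.C (G i j) * (gramBasis i * gramBasis j)) =
      vec6 (vecMulVec a a) ⬝ᵥ (G *ᵥ vec6 (vecMulVec a a)) := by
  have hm : ∀ i, eval a (gramBasis i) = vec6 (vecMulVec a a) i := by
    intro i
    fin_cases i <;> simp [gramBasis, vec6, vecMulVec_apply] <;> ring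
  simp only [map_sum, map_mul, eval_C, hm, dotProduct, mulVec, Finset.mul_sum]
  refine Finset.sum_congr rfl fun i _ => Finset.sum_congr rfl fun j _ => by ring

theorem refl_aut (f : MvPolynomial (Fin 3) ℝ) (G : Matrix (Fin 6) (Fin 6) ℝ) (hGs : Gᵀ = G)
    (hG : (∑ i, ∑ j, MvPolynomial.C (G i j) * (gramBasis i * gramBasis j)) = f)
    (h : HasRefl (kerSpace G)) : HasOrder2Aut f := by
  obtain ⟨p, φ, h1, h2⟩ := h
  let A : Matrix (Fin 3) (Fin 3) ℝ := 1 - (2 : ℝ) • vecMulVec p φ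
  have hA : ∀ x, A *ᵥ x = x - (2 * (φ ⬝ᵥ x)) • p := by
    intro x
    simp only [A, sub_mulVec, one_mulVec, smul_mulVec, vecMulVec_mulVec]
    ext i
    simp
    ring
  have hAA : A * A = 1 := by
    have e : vecMulVec p φ * vecMulVec p φ = vecMulVec p φ := by
      rw [vecMulVec_mul_vecMulVec, h1]; simp
    simp only [A, Matrix.mul_sub, Matrix.sub_mul, Matrix.mul_one, Matrix.one_mul, Matrix.mul_smul,
      Matrix.smul_mul, e]
    module
  have hinv : ∀ x, eval (A *ᵥ x) f = eval x f := by
    intro x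
    set s := φ ⬝ᵥ x with hs
    let w := x - s • p
    have hw : φ ⬝ᵥ w = 0 := by
      simp only [w, dotProduct_sub, dotProduct_smul, h1, ← hs]; simp
    obtain ⟨-, hk⟩ := h2 w hw
    set v := vec6 (vecMulVec p w + vecMulVec w p) with hv
    have hvec : vec6 (vecMulVec (A *ᵥ x) (A *ᵥ x)) = vec6 (vecMulVec x x) - (2 * s) • v := by
      rw [hA, hv, ← hs]
      ext i
      fin_cases i <;> simp [vec6, vecMulVec_apply, w] <;> ring
    have hk2 : ∀ u, v ⬝ᵥ (G *ᵥ u) = 0 := by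
      intro u
      rw [dotProduct_mulVec, ← mulVec_transpose, hGs, hk, zero_dotProduct]
    rw [← hG, eval_gram, eval_gram, hvec]
    simp [mulVec_sub, mulVec_smul, hk, hk2, sub_dotProduct]
  have hreal : bind₁ (fun i => ∑ j, MvPolynomial.C (A i j) * X j) f = f := by
    apply MvPolynomial.funext
    intro x
    rw [← hinv x]
    simp only [eval, eval₂Hom_bind₁]
    congr 2
    ext i
    simp [mulVec, dotProduct]
  -- a fixed vector orthogonal to `φ`
  have hns : ¬ ∃ c : ℝ, A = c • (1 : Matrix (Fin 3) (Fin 3) ℝ) := by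
    rintro ⟨c, hc⟩
    have e : ∀ i j, (1 : Matrix (Fin 3) (Fin 3) ℝ) i j - 2 * (p i * φ j) = c * (1 : Matrix (Fin 3) (Fin 3) ℝ) i j := by
      intro i j
      have := congrFun (congrFun hc i) j
      simpa [A, vecMulVec_apply] using this
    have hp := h1
    simp [dotProduct, Fin.sum_univ_succ] at hp
    have e00 := e 0 0
    have e11 := e 1 1
    have e22 := e 2 2
    have e01 := e 0 1
    have e02 := e 0 2
    have e12 := e 1 2
    simp at e00 e11 e22 e01 e02 e12
    have hc1 : c = 1 / 3 := by linarith
    have g0 : p 0 * φ 0 = 1 / 3 := by linarith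
    have g1 : p 1 * φ 1 = 1 / 3 := by linarith
    rcases e01 with e01 | e01
    · rw [e01] at g0; norm_num at g0
    · rw [e01] at g1; norm_num at g1
  refine ⟨A.map (algebraMap ℝ ℂ), ?_, ?_, ⟨1, ?_⟩, ?_⟩
  · rw [← RingHom.mapMatrix_apply, ← RingHom.map_det]
    apply IsUnit.map
    exact (Matrix.isUnit_iff_isUnit_det A).mp (IsUnit.of_mul_eq_one _ hAA)
  · rintro ⟨c, hc⟩
    apply hns
    refine ⟨c.re, ?_⟩
    ext i j
    have := congrArg Complex.re (congrFun (congrFun hc i) j)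
    simp only [Matrix.map_apply, Matrix.smul_apply, one_apply] at this ⊢
    split_ifs at this ⊢ <;> simpa using this
  · rw [← Matrix.map_mul, hAA, one_smul]
    exact Matrix.map_one _ (map_zero _) (map_one _)
  · have := congrArg (map (algebraMap ℝ ℂ)) hreal
    rw [map_bind₁] at this
    simp only [map_sum, map_mul, map_C, map_X] at this
    exact this

theorem psd_mid {G₁ G₂ : Matrix (Fin 6) (Fin 6) ℝ} (h1 : G₁.PosSemidef) (h2 : G₂.PosSemidef)
    (x : Fin 6 → ℝ) (hx : ((1 / 2 : ℝ) • G₁ + (1 - 1 / 2 : ℝ) • G₂) *ᵥ x = 0) :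
    G₁ *ᵥ x = 0 ∧ G₂ *ᵥ x = 0 := by
  have a1 := h1.dotProduct_mulVec_nonneg x
  have a2 := h2.dotProduct_mulVec_nonneg x
  have e : star x ⬝ᵥ (((1 / 2 : ℝ) • G₁ + (1 - 1 / 2 : ℝ) • G₂) *ᵥ x) = 0 := by
    rw [hx, dotProduct_zero]
  simp only [add_mulVec, smul_mulVec, dotProduct_add, dotProduct_smul, smul_eq_mul] at e
  exact ⟨(h1.dotProduct_mulVec_zero_iff x).mp (by linarith),
    (h2.dotProduct_mulVec_zero_iff x).mp (by linarith)⟩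

theorem gram_add_smul (G S : Matrix (Fin 6) (Fin 6) ℝ) (c : ℝ) :
    (∑ i, ∑ j, MvPolynomial.C ((G + c • S) i j) * (gramBasis i * gramBasis j)) =
    (∑ i, ∑ j, MvPolynomial.C (G i j) * (gramBasis i * gramBasis j)) +
    MvPolynomial.C c * (∑ i, ∑ j, MvPolynomial.C (S i j) * (gramBasis i * gramBasis j)) := by
  simp only [Finset.mul_sum, ← Finset.sum_add_distrib]
  refine Finset.sum_congr rfl fun i _ => Finset.sum_congr rfl fun j _ => ?_
  simp only [Matrix.add_apply, Matrix.smul_apply, smul_eq_mul, map_add, map_mul]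
  ring

theorem exists_vec6 (x : Fin 6 → ℝ) : ∃ M : Matrix (Fin 3) (Fin 3) ℝ, Mᵀ = M ∧ vec6 M = x := by
  refine ⟨!![x 0, x 3, x 4; x 3, x 1, x 5; x 4, x 5, x 2], ?_, ?_⟩
  · ext i j; fin_cases i <;> fin_cases j <;> rfl
  · ext i; fin_cases i <;> rfl

/-- If the Gram spectrahedron of a smooth psd ternary quartic has a face of
dimension 1, then `f` has an automorphism of order 2. -/
theorem one_dimensional_face_implies_order_two_automorphism
    (f : MvPolynomial (Fin 3) ℝ) (hhom : f.IsHomogeneous 4)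
    (hsm : IsSmooth f) (hpsd : IsPsd f)
    (F : Set (Matrix (Fin 6) (Fin 6) ℝ))
    (hF : IsFace (GramSpectrahedron f) F)
    (hdim : Module.finrank ℝ (vectorSpan ℝ F) = 1) :
    HasOrder2Aut f := by
  obtain ⟨hsub, hconv, hface⟩ := hF
  have hnt : F.Nontrivial := by
    by_contra hc
    rw [Set.not_nontrivial_iff] at hc
    rw [vectorSpan_of_subsingleton ℝ hc] at hdim
    simp at hdim
  obtain ⟨G₁, hG1, G₂, hG2, hne⟩ := hnt
  obtain ⟨p1, r1⟩ := hsub hG1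
  obtain ⟨p2, r2⟩ := hsub hG2
  set G := (1 / 2 : ℝ) • G₁ + (1 - 1 / 2 : ℝ) • G₂ with hGdef
  have hGF : G ∈ F := hconv hG1 hG2 (by norm_num) (by norm_num) (by norm_num)
  obtain ⟨pG, rG⟩ := hsub hGF
  have sG : Gᵀ = G := by simpa using pG.1.eq
  have s1 : G₁ᵀ = G₁ := by simpa using p1.1.eq
  have s2 : G₂ᵀ = G₂ := by simpa using p2.1.eq
  -- the direction of the face
  have hrel : (∑ i, ∑ j, MvPolynomial.C ((G₁ - G₂) i j) * (gramBasis i * gramBasis j)) = 0 := by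
    have := gram_add_smul G₁ G₂ (-1)
    rw [r1, r2] at this
    have e : G₁ + (-1 : ℝ) • G₂ = G₁ - G₂ := by module
    rw [e] at this
    rw [this]; simp
  obtain ⟨B, hB, hBS⟩ := rel_exists (G₁ - G₂) (by rw [transpose_sub, s1, s2]) hrel
  have hBne : B ≠ 0 := by
    rintro rfl
    have : relMat 0 = 0 := by simpa using relMat_smul 0 0
    rw [this] at hBS
    exact hne (sub_eq_zero.mp hBS.symm)
  have hdir : G₁ - G₂ ∈ vectorSpan ℝ F := vsub_mem_vectorSpan ℝ hG1 hG2
  have hspan : ∀ S ∈ vectorSpan ℝ F, ∃ c : ℝ, c • (G₁ - G₂) = S := by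
    intro S hS
    obtain ⟨c, hc⟩ := (finrank_eq_one_iff_of_nonzero' (⟨G₁ - G₂, hdir⟩ : vectorSpan ℝ F)
      (by simpa [sub_eq_zero] using hne)).mp hdim ⟨S, hS⟩
    exact ⟨c, congrArg Subtype.val hc⟩
  have good : GoodPair (kerSpace G) B := by
    refine ⟨fun M hM => hM.1, hB, ?_, ?_, ?_⟩
    · intro M hM
      rw [← relMat_mulVec_zero B M hB hM.1, hBS, sub_mulVec]
      obtain ⟨a, b⟩ := psd_mid p1 p2 _ hM.2
      rw [a, b, sub_zero]
    · intro B' hB' hK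
      obtain ⟨ε, hε, q1, q2⟩ := psd_perturb G (relMat B') pG (relMat_symm B') (by
        intro x hx
        obtain ⟨M, hM, rfl⟩ := exists_vec6 x
        exact (relMat_mulVec_zero B' M hB' hM).mpr (hK M ⟨hM, hx⟩))
      have m1 : G + ε • relMat B' ∈ GramSpectrahedron f :=
        ⟨q1, by rw [gram_add_smul, rG, relMat_rel]; simp⟩
      have m2 : G - ε • relMat B' ∈ GramSpectrahedron f :=
        ⟨q2, by rw [sub_eq_add_neg, ← neg_smul, gram_add_smul, rG, relMat_rel]; simp⟩
      obtain ⟨f1, f2⟩ := hface _ m1 _ m2 (1 / 2) (by norm_num) (by norm_num) (by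
        have : (1 / 2 : ℝ) • (G + ε • relMat B') + (1 - 1 / 2 : ℝ) • (G - ε • relMat B') = G := by
          module
        rwa [this])
      have hd := vsub_mem_vectorSpan ℝ f1 hGF
      obtain ⟨c, hc⟩ := hspan _ hd
      refine ⟨ε⁻¹ * c, relMat_inj _ _ hB' (by rw [transpose_smul, hB]) ?_⟩
      rw [relMat_smul, hBS, mul_smul, hc, vsub_eq_sub, add_sub_cancel_left, smul_smul,
        inv_mul_cancel₀ hε.ne', one_smul]
    · intro M₁ h1 M₂ h2 t a ha
      apply no_rank_one f hsm G sG rG a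
      rw [ha]
      have ev : vec6 (M₁.map (algebraMap ℝ ℂ) + t • M₂.map (algebraMap ℝ ℂ)) =
          (algebraMap ℝ ℂ) ∘ vec6 M₁ + t • ((algebraMap ℝ ℂ) ∘ vec6 M₂) := by
        ext i; fin_cases i <;> rfl
      have em : ∀ v : Fin 6 → ℝ, G *ᵥ v = 0 →
          G.map (algebraMap ℝ ℂ) *ᵥ ((algebraMap ℝ ℂ) ∘ v) = 0 := by
        intro v hv
        ext i
        have := RingHom.map_mulVec (algebraMap ℝ ℂ) G v i
        rw [hv] at this
        rw [← this]; simp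
      rw [ev, mulVec_add, mulVec_smul, em _ h1.2, em _ h2.2]
      simp
  exact refl_aut f G sG rG (good_refl _ _ good hBne)
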